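/- Let p, q ∈ (1, ∞) be conjugate exponents (1/p + 1/q = 1). Let ‖·‖ be a norm on ℝ^k with dual norm ‖y‖_* = sup_{‖x‖ ≤ 1} ⟨x, y⟩. Let l : ℝ^k → ℝ be Lipschitz continuous and continuously differentiable, and let μ be a probability measure on ℝ^k with finite p-th moment. Define V(δ) = sup { ∫ l dη : η a probability measure on ℝ^k with W_p(μ, η) ≤ δ } and Υ := (∫ ‖∇l(x)‖_*^q dμ(x))^{1/q}. Then V(δ) = V(0) + δ·Υ + o(δ) as δ ↓ 0, i.e. lim_{δ → 0+} (V(δ) − V(0) − δΥ)/δ = 0. -/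

import Mathlib

open MeasureTheory Filter
open scoped ENNReal NNReal

noncomputable section

/-- The standard inner product pairing on `ℝ^k`. -/
def pairing {k : ℕ} (x y : Fin k → ℝ) : ℝ := ∑ i, x i * y i

/-- `nrm` is a norm on `ℝ^k`. -/
structure IsNorm {k : ℕ} (nrm : (Fin k → ℝ) → ℝ) : Prop where
  triangle : ∀ x y, nrm (x + y) ≤ nrm x + nrm y
  smul : ∀ (c : ℝ) (x : Fin k → ℝ), nrm (c • x) = |c| * nrm x
  pos : ∀ x, x ≠ 0 → 0 < nrm x

/-- The dual norm `‖y‖_* = sup_{‖x‖ ≤ 1} ⟨x, y⟩`. -/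
def dualNorm {k : ℕ} (nrm : (Fin k → ℝ) → ℝ) (y : Fin k → ℝ) : ℝ :=
  sSup {r | ∃ x, nrm x ≤ 1 ∧ r = pairing x y}

/-- The gradient of `l : ℝ^k → ℝ` with respect to the standard basis. -/
def grad {k : ℕ} (l : (Fin k → ℝ) → ℝ) (x : Fin k → ℝ) : Fin k → ℝ :=
  fun i => fderiv ℝ l x (Pi.single i 1)

/-- The `p`-Wasserstein distance (with respect to the norm `nrm`), as an
infimum over all couplings of `μ` and `ν`. -/
def Wp {k : ℕ} (p : ℝ) (nrm : (Fin k → ℝ) → ℝ) (μ ν : Measure (Fin k → ℝ)) : ℝ≥0∞ :=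
  ⨅ (π : Measure ((Fin k → ℝ) × (Fin k → ℝ))) (_ : IsProbabilityMeasure π)
    (_ : π.map Prod.fst = μ) (_ : π.map Prod.snd = ν),
    (∫⁻ z, ENNReal.ofReal (nrm (z.1 - z.2) ^ p) ∂π) ^ (1 / p)

/-- The robust value `V(δ) = sup { ∫ l dη : W_p(μ, η) ≤ δ }`. -/
def Vrob {k : ℕ} (p : ℝ) (nrm : (Fin k → ℝ) → ℝ) (l : (Fin k → ℝ) → ℝ)
    (μ : Measure (Fin k → ℝ)) (δ : ℝ) : ℝ :=
  sSup {r | ∃ η : Measure (Fin k → ℝ), IsProbabilityMeasure η ∧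
    Wp p nrm μ η ≤ ENNReal.ofReal δ ∧ r = ∫ x, l x ∂η}

namespace IsNorm

variable {k : ℕ} {nrm : (Fin k → ℝ) → ℝ}

lemma zero (h : IsNorm nrm) : nrm 0 = 0 := by
  simpa using h.smul 0 0

lemma nonneg (h : IsNorm nrm) (x : Fin k → ℝ) : 0 ≤ nrm x := by
  rcases eq_or_ne x 0 with rfl | hx
  · exact h.zero.ge
  · exact (h.pos x hx).le

lemma neg (h : IsNorm nrm) (x : Fin k → ℝ) : nrm (-x) = nrm x := by
  simpa using h.smul (-1) x

lemma sub_comm (h : IsNorm nrm) (x y : Fin k → ℝ) : nrm (x - y) = nrm (y - x) := by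
  rw [← h.neg, neg_sub]

lemma continuous (h : IsNorm nrm) : Continuous nrm := by
  have hc : ConvexOn ℝ Set.univ nrm := by
    refine ⟨convex_univ, fun x _ y _ a b ha hb _ => ?_⟩
    calc nrm (a • x + b • y) ≤ nrm (a • x) + nrm (b • y) := h.triangle _ _
      _ = a • nrm x + b • nrm y := by
        rw [h.smul, h.smul, abs_of_nonneg ha, abs_of_nonneg hb, smul_eq_mul, smul_eq_mul]
  exact hc.locallyLipschitz.continuous

/-- Every norm on `ℝ^k` dominates a multiple of the sup norm. -/
lemma exists_norm_le_mul (h : IsNorm nrm) : ∃ C : ℝ, 0 < C ∧ ∀ x, ‖x‖ ≤ C * nrm x := by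
  obtain ⟨c, hc, hcs⟩ : ∃ c : ℝ, 0 < c ∧ ∀ x ∈ Metric.sphere (0 : Fin k → ℝ) 1, c ≤ nrm x :=
    (isCompact_sphere _ _).exists_forall_le' h.continuous.continuousOn
      fun x hx => h.pos x (ne_zero_of_mem_unit_sphere ⟨x, hx⟩)
  refine ⟨c⁻¹, inv_pos.2 hc, fun x => ?_⟩
  rcases eq_or_ne x 0 with rfl | hx
  · simp [h.zero]
  have hx' : 0 < ‖x‖ := norm_pos_iff.2 hx
  have hu := hcs (‖x‖⁻¹ • x) (by simp [norm_smul, hx'.ne'])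
  rw [h.smul, abs_of_pos (inv_pos.2 hx'), le_inv_mul_iff₀ hx'] at hu
  rwa [le_inv_mul_iff₀ hc, mul_comm]

lemma isCompact_unitBall (h : IsNorm nrm) : IsCompact {x | nrm x ≤ 1} := by
  obtain ⟨C, hC, hle⟩ := h.exists_norm_le_mul
  refine Metric.isCompact_of_isClosed_isBounded
    (isClosed_le h.continuous continuous_const) ?_
  refine isBounded_iff_forall_norm_le.2 ⟨C, fun x hx => (hle x).trans ?_⟩
  exact mul_le_of_le_one_right hC.le hx

end IsNorm

section Pairing

variable {k : ℕ}

lemma pairing_smul_left (c : ℝ) (x y : Fin k → ℝ) : pairing (c • x) y = c * pairing x y := by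
  simp [pairing, Finset.mul_sum, mul_assoc]

lemma pairing_neg_left (x y : Fin k → ℝ) : pairing (-x) y = -pairing x y := by
  simp [pairing]

lemma pairing_sub_right (x y z : Fin k → ℝ) :
    pairing x (y - z) = pairing x y - pairing x z := by
  simp [pairing, mul_sub]

lemma continuous_pairing : Continuous fun z : (Fin k → ℝ) × (Fin k → ℝ) => pairing z.1 z.2 := by
  unfold pairing
  fun_prop

lemma pairing_le_norm (x y : Fin k → ℝ) : pairing x y ≤ k * (‖x‖ * ‖y‖) := by
  calc pairing x y ≤ ∑ _ : Fin k, ‖x‖ * ‖y‖ := by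
        refine Finset.sum_le_sum fun i _ => (le_abs_self _).trans ?_
        rw [abs_mul]
        exact mul_le_mul (norm_le_pi_norm x i) (norm_le_pi_norm y i) (abs_nonneg _) (norm_nonneg _)
    _ = k * (‖x‖ * ‖y‖) := by simp

lemma fderiv_eq_pairing_grad (l : (Fin k → ℝ) → ℝ) (x h : Fin k → ℝ) :
    fderiv ℝ l x h = pairing h (grad l x) := by
  conv_lhs => rw [pi_eq_sum_univ' h, map_sum]
  simp only [pairing, grad]
  refine Finset.sum_congr rfl fun i _ => ?_
  rw [map_smul, smul_eq_mul]

lemma continuous_grad {l : (Fin k → ℝ) → ℝ} (hl : ContDiff ℝ 1 l) : Continuous (grad l) :=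
  continuous_pi fun _ => (hl.continuous_fderiv one_ne_zero).clm_apply continuous_const

lemma norm_grad_le {l : (Fin k → ℝ) → ℝ} {K : ℝ≥0} (hl : LipschitzWith K l) (x : Fin k → ℝ) :
    ‖grad l x‖ ≤ K := by
  refine (pi_norm_le_iff_of_nonneg K.2).2 fun i => ?_
  calc ‖grad l x i‖ ≤ ‖fderiv ℝ l x‖ * ‖(Pi.single i 1 : Fin k → ℝ)‖ :=
        (fderiv ℝ l x).le_opNorm _
    _ ≤ K := by
      rw [Pi.norm_single, norm_one, mul_one]
      exact norm_fderiv_le_of_lipschitz ℝ hl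

end Pairing

section DualNorm

variable {k : ℕ} {nrm : (Fin k → ℝ) → ℝ}

lemma bddAbove_pairing_unitBall (h : IsNorm nrm) (y : Fin k → ℝ) :
    BddAbove {r | ∃ x, nrm x ≤ 1 ∧ r = pairing x y} := by
  have := (h.isCompact_unitBall.image
    (continuous_pairing.comp (Continuous.prodMk_left y))).bddAbove
  refine this.mono ?_
  rintro _ ⟨x, hx, rfl⟩
  exact ⟨x, hx, rfl⟩

lemma pairing_le_dualNorm (h : IsNorm nrm) {x : Fin k → ℝ} (hx : nrm x ≤ 1) (y : Fin k → ℝ) :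
    pairing x y ≤ dualNorm nrm y :=
  le_csSup (bddAbove_pairing_unitBall h y) ⟨x, hx, rfl⟩

lemma dualNorm_le (h : IsNorm nrm) {y : Fin k → ℝ} {a : ℝ}
    (ha : ∀ x, nrm x ≤ 1 → pairing x y ≤ a) : dualNorm nrm y ≤ a :=
  csSup_le ⟨_, 0, by simp [h.zero], rfl⟩ (by rintro _ ⟨x, hx, rfl⟩; exact ha x hx)

lemma dualNorm_nonneg (h : IsNorm nrm) (y : Fin k → ℝ) : 0 ≤ dualNorm nrm y := by
  simpa [pairing] using pairing_le_dualNorm h (x := 0) (by simp [h.zero]) y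

/-- The generalized Cauchy–Schwarz inequality. -/
lemma pairing_le_nrm_mul_dualNorm (h : IsNorm nrm) (x y : Fin k → ℝ) :
    pairing x y ≤ nrm x * dualNorm nrm y := by
  rcases eq_or_ne x 0 with rfl | hx
  · simp [pairing, h.zero]
  have hx' := h.pos x hx
  have hu := pairing_le_dualNorm h (x := (nrm x)⁻¹ • x)
    (by rw [h.smul, abs_of_pos (inv_pos.2 hx'), inv_mul_cancel₀ hx'.ne']) y
  rwa [pairing_smul_left, inv_mul_le_iff₀ hx'] at hu

lemma abs_pairing_le (h : IsNorm nrm) (x y : Fin k → ℝ) :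
    |pairing x y| ≤ nrm x * dualNorm nrm y := by
  refine abs_le'.2 ⟨pairing_le_nrm_mul_dualNorm h x y, ?_⟩
  rw [← pairing_neg_left, ← h.neg x]
  exact pairing_le_nrm_mul_dualNorm h (-x) y

lemma exists_dualNorm_le_add_mul (h : IsNorm nrm) :
    ∃ M : ℝ, 0 ≤ M ∧ ∀ y z, dualNorm nrm y ≤ dualNorm nrm z + M * ‖y - z‖ := by
  obtain ⟨C, hC, hle⟩ := h.exists_norm_le_mul
  refine ⟨k * C, by positivity, fun y z => dualNorm_le h fun x hx => ?_⟩
  have hxC : ‖x‖ ≤ C := (hle x).trans (mul_le_of_le_one_right hC.le hx)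
  have h1 := pairing_le_norm x (y - z)
  rw [pairing_sub_right] at h1
  have h2 : (k : ℝ) * (‖x‖ * ‖y - z‖) ≤ k * C * ‖y - z‖ := by
    rw [mul_assoc]
    gcongr
  linarith [pairing_le_dualNorm h hx z]

lemma continuous_dualNorm (h : IsNorm nrm) : Continuous (dualNorm nrm) := by
  obtain ⟨M, -, hM⟩ := exists_dualNorm_le_add_mul h
  exact (LipschitzWith.of_le_add_mul' M fun y z => by
    rw [dist_eq_norm]; exact hM y z).continuous

lemma exists_dualNorm_grad_le (h : IsNorm nrm) {l : (Fin k → ℝ) → ℝ}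
    (hl : ∃ K : ℝ≥0, LipschitzWith K l) :
    ∃ B : ℝ, 0 ≤ B ∧ ∀ x, dualNorm nrm (grad l x) ≤ B := by
  obtain ⟨K, hK⟩ := hl
  obtain ⟨M, hM0, hM⟩ := exists_dualNorm_le_add_mul h
  refine ⟨dualNorm nrm 0 + M * K, add_nonneg (dualNorm_nonneg h 0) (by positivity), fun x => ?_⟩
  refine (hM _ 0).trans ?_
  rw [sub_zero]
  gcongr
  exact norm_grad_le hK x

/-- A Borel choice of an almost optimal direction in the unit ball. -/
lemma exists_measurable_dualNorm_le_pairing_add (h : IsNorm nrm) {ε : ℝ} (hε : 0 < ε) :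
    ∃ J : (Fin k → ℝ) → (Fin k → ℝ), Measurable J ∧ (∀ y, nrm (J y) ≤ 1) ∧
      ∀ y, dualNorm nrm y ≤ pairing (J y) y + ε := by
  classical
  have : Nonempty {x | nrm x ≤ 1} := ⟨0, by simp [h.zero]⟩
  let d : ℕ → {x | nrm x ≤ 1} := TopologicalSpace.denseSeq _
  let P : ℕ → (Fin k → ℝ) → Prop := fun n y => dualNorm nrm y < pairing (d n) y + ε
  have hP : ∀ n, MeasurableSet {y | P n y} := fun n =>
    (isOpen_lt (continuous_dualNorm h)
      ((continuous_pairing.comp (Continuous.prodMk_right (d n : Fin k → ℝ))).add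
        continuous_const)).measurableSet
  have hex : ∀ y, ∃ n, P n y := fun y => by
    obtain ⟨_, ⟨x, hx, rfl⟩, hlt⟩ := exists_lt_of_lt_csSup
      (s := {r | ∃ x, nrm x ≤ 1 ∧ r = pairing x y}) ⟨_, 0, by simp [h.zero], rfl⟩
      (sub_lt_self (dualNorm nrm y) hε)
    have hopen : IsOpen {x : {x | nrm x ≤ 1} | dualNorm nrm y < pairing x y + ε} :=
      isOpen_lt continuous_const
        (((continuous_pairing.comp (Continuous.prodMk_left y)).comp
          continuous_subtype_val).add continuous_const)
    obtain ⟨_, hmem, n, rfl⟩ := (TopologicalSpace.denseRange_denseSeq _).inter_open_nonempty _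
      hopen ⟨⟨x, hx⟩, sub_lt_iff_lt_add.1 hlt⟩
    exact ⟨n, hmem⟩
  refine ⟨fun y => d (Nat.find (hex y)), ?_, fun y => (d _).2, fun y => (Nat.find_spec (hex y)).le⟩
  exact Measurable.find (f := fun n _ => (d n : Fin k → ℝ)) (fun n => measurable_const) hP hex

end DualNorm

section MeanValue

variable {k : ℕ} {nrm : (Fin k → ℝ) → ℝ} {l : (Fin k → ℝ) → ℝ}

lemma exists_sub_le_nrm_mul_dualNorm_grad (h : IsNorm nrm) (hl : Differentiable ℝ l)
    (x y : Fin k → ℝ) : ∃ t ∈ Set.Icc (0 : ℝ) 1,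
      l y - l x ≤ nrm (y - x) * dualNorm nrm (grad l (x + t • (y - x))) := by
  obtain ⟨z, hz, hzeq⟩ := domain_mvt (f := l) (f' := fderiv ℝ l)
    (fun x _ => (hl x).hasFDerivAt.hasFDerivWithinAt) convex_univ
    (Set.mem_univ x) (Set.mem_univ y)
  rw [segment_eq_image'] at hz
  obtain ⟨t, ht, rfl⟩ := hz
  refine ⟨t, ht, ?_⟩
  rw [hzeq, fderiv_eq_pairing_grad]
  exact pairing_le_nrm_mul_dualNorm h _ _

lemma abs_sub_le_mul_nrm (h : IsNorm nrm) (hl : Differentiable ℝ l) {B : ℝ}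
    (hB : ∀ x, dualNorm nrm (grad l x) ≤ B) (x y : Fin k → ℝ) :
    |l y - l x| ≤ B * nrm (x - y) := by
  have key : ∀ x y, l y - l x ≤ B * nrm (y - x) := fun x y => by
    obtain ⟨t, -, ht⟩ := exists_sub_le_nrm_mul_dualNorm_grad h hl x y
    rw [mul_comm]
    exact ht.trans (mul_le_mul_of_nonneg_left (hB _) (h.nonneg _))
  refine abs_sub_le_iff.2 ⟨?_, key y x⟩
  rw [h.sub_comm]
  exact key x y

/-- The supremum of `g` over the ball of radius `r` around `x`. -/
def ballSup (nrm : (Fin k → ℝ) → ℝ) (g : (Fin k → ℝ) → ℝ) (r : ℝ) (x : Fin k → ℝ) : ℝ :=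
  sSup ((fun h => g (x + r • h)) '' {h | nrm h ≤ 1})

variable {g : (Fin k → ℝ) → ℝ}

lemma continuous_ballSup (h : IsNorm nrm) (hg : Continuous g) :
    Continuous fun z : ℝ × (Fin k → ℝ) => ballSup nrm g z.1 z.2 := by
  have : Continuous ↿fun (z : ℝ × (Fin k → ℝ)) (v : Fin k → ℝ) => g (z.2 + z.1 • v) := by
    simp only [Function.HasUncurry.uncurry, id]
    fun_prop
  exact h.isCompact_unitBall.continuous_sSup this

lemma ballSup_zero (h : IsNorm nrm) (x : Fin k → ℝ) : ballSup nrm g 0 x = g x := by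
  have hne : {v | nrm v ≤ 1}.Nonempty := ⟨0, by simp [h.zero]⟩
  simp [ballSup, hne.image_const]

lemma ballSup_le (h : IsNorm nrm) {B : ℝ} (hB : ∀ x, g x ≤ B) (r : ℝ) (x : Fin k → ℝ) :
    ballSup nrm g r x ≤ B :=
  csSup_le (Set.Nonempty.image _ ⟨0, by simp [h.zero]⟩) (by rintro _ ⟨v, -, rfl⟩; exact hB _)

lemma le_ballSup {B : ℝ} (hB : ∀ x, g x ≤ B) {r : ℝ} {x v : Fin k → ℝ} (hv : nrm v ≤ 1) :
    g (x + r • v) ≤ ballSup nrm g r x :=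
  le_csSup ⟨B, by rintro _ ⟨v, -, rfl⟩; exact hB _⟩ ⟨v, hv, rfl⟩

lemma ballSup_nonneg (h : IsNorm nrm) {B : ℝ} (hB : ∀ x, g x ≤ B) (hg : ∀ x, 0 ≤ g x)
    (r : ℝ) (x : Fin k → ℝ) : 0 ≤ ballSup nrm g r x :=
  (hg _).trans (le_ballSup hB (v := 0) (by simp [h.zero]))

lemma sub_le_ballSup_mul_add (h : IsNorm nrm) (hl : Differentiable ℝ l) {B p r : ℝ}
    (hB0 : 0 ≤ B) (hB : ∀ x, dualNorm nrm (grad l x) ≤ B) (hp : 1 < p) (hr : 0 < r)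
    (x y : Fin k → ℝ) :
    l y - l x ≤ ballSup nrm (fun z => dualNorm nrm (grad l z)) r x * nrm (x - y) +
      B / r ^ (p - 1) * nrm (x - y) ^ p := by
  have hn := h.nonneg (x - y)
  have hT := ballSup_nonneg h hB (fun z => dualNorm_nonneg h (grad l z)) r x
  have hrp := Real.rpow_pos_of_pos hr (p - 1)
  rcases le_or_gt (nrm (x - y)) r with hle | hgt
  · obtain ⟨t, ht, hlt⟩ := exists_sub_le_nrm_mul_dualNorm_grad h hl x y
    have hv : nrm ((t / r) • (y - x)) ≤ 1 := by
      rw [h.smul, abs_of_nonneg (div_nonneg ht.1 hr.le), h.sub_comm, div_mul_eq_mul_div,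
        div_le_one hr]
      exact (mul_le_of_le_one_left hn ht.2).trans hle
    have hsup := le_ballSup (r := r) (x := x) hB hv
    rw [smul_smul, mul_div_cancel₀ _ hr.ne'] at hsup
    have h1 : l y - l x ≤ ballSup nrm (fun z => dualNorm nrm (grad l z)) r x * nrm (x - y) := by
      rw [mul_comm, h.sub_comm x y]
      exact hlt.trans (mul_le_mul_of_nonneg_left hsup (h.nonneg _))
    have h2 : 0 ≤ B / r ^ (p - 1) * nrm (x - y) ^ p := by positivity
    linarith
  · have h1 := (le_abs_self _).trans (abs_sub_le_mul_nrm h hl hB x y)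
    have h2 : B * nrm (x - y) ≤ B / r ^ (p - 1) * nrm (x - y) ^ p := by
      have hpos := hr.trans hgt
      have : r ^ (p - 1) ≤ nrm (x - y) ^ (p - 1) :=
        Real.rpow_le_rpow hr.le hgt.le (by linarith)
      calc B * nrm (x - y) ≤ B * nrm (x - y) * (nrm (x - y) ^ (p - 1) / r ^ (p - 1)) :=
            le_mul_of_one_le_right (by positivity) ((one_le_div hrp).2 this)
        _ = B / r ^ (p - 1) * nrm (x - y) ^ p := by
            rw [Real.rpow_sub_one hpos.ne' p]
            field_simp
    have h3 := mul_nonneg hT hn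
    linarith

end MeanValue

section Transport

variable {k : ℕ} {nrm : (Fin k → ℝ) → ℝ} {l : (Fin k → ℝ) → ℝ} {μ : Measure (Fin k → ℝ)}
  {p q δ : ℝ}

lemma exists_coupling_of_Wp_lt {η : Measure (Fin k → ℝ)} (hp : 0 < p)
    (h : Wp p nrm μ η < ENNReal.ofReal δ) :
    ∃ π : Measure ((Fin k → ℝ) × (Fin k → ℝ)), IsProbabilityMeasure π ∧
      π.map Prod.fst = μ ∧ π.map Prod.snd = η ∧
      ∫⁻ z, ENNReal.ofReal (nrm (z.1 - z.2) ^ p) ∂π ≤ ENNReal.ofReal (δ ^ p) := by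
  simp only [Wp, iInf_lt_iff] at h
  obtain ⟨π, hπ, hfst, hsnd, hlt⟩ := h
  refine ⟨π, hπ, hfst, hsnd, ?_⟩
  have hδ : 0 < δ := by
    by_contra! hneg
    simp [ENNReal.ofReal_of_nonpos hneg] at hlt
  rw [← ENNReal.ofReal_rpow_of_pos hδ, ← ENNReal.rpow_inv_le_iff hp, ← one_div]
  exact hlt.le

/-- Upper bound for expectations along a coupling, by Hölder's inequality. -/
lemma integral_snd_le_of_coupling (h : IsNorm nrm) (hpq : p.HolderConjugate q)
    (hl : Continuous l) {T : (Fin k → ℝ) → ℝ} {B c : ℝ} (hT : Continuous T)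
    (hT0 : ∀ x, 0 ≤ T x) (hTB : ∀ x, T x ≤ B) (hc : 0 ≤ c)
    (hbound : ∀ x y, l y - l x ≤ T x * nrm (x - y) + c * nrm (x - y) ^ p)
    (habs : ∀ x y, |l y - l x| ≤ B * nrm (x - y))
    (π : Measure ((Fin k → ℝ) × (Fin k → ℝ))) [IsProbabilityMeasure π] (hδ : 0 ≤ δ)
    (hint : Integrable (fun z => l z.1) π)
    (hcost : ∫⁻ z, ENNReal.ofReal (nrm (z.1 - z.2) ^ p) ∂π ≤ ENNReal.ofReal (δ ^ p)) :
    ∫ z, l z.2 ∂π ≤ ∫ z, l z.1 ∂π + δ * (∫ z, T z.1 ^ q ∂π) ^ (1 / q) + c * δ ^ p := by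
  let N : (Fin k → ℝ) × (Fin k → ℝ) → ℝ := fun z => nrm (z.1 - z.2)
  have hNc : Continuous N := h.continuous.comp (continuous_fst.sub continuous_snd)
  have hN0 : ∀ z, 0 ≤ N z := fun z => h.nonneg _
  have hNpi : Integrable (fun z => N z ^ p) π := by
    refine ⟨(hNc.rpow_const fun _ => Or.inr hpq.nonneg).aestronglyMeasurable, ?_⟩
    rw [hasFiniteIntegral_iff_ofReal (ae_of_all _ fun z => Real.rpow_nonneg (hN0 z) p)]
    exact hcost.trans_lt ENNReal.ofReal_lt_top
  have hNple : ∫ z, N z ^ p ∂π ≤ δ ^ p := by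
    rw [integral_eq_lintegral_of_nonneg_ae (ae_of_all _ fun z => Real.rpow_nonneg (hN0 z) p)
      hNpi.aestronglyMeasurable]
    exact ENNReal.toReal_le_of_le_ofReal (Real.rpow_nonneg hδ p) hcost
  have hNL : MemLp N (ENNReal.ofReal p) π := by
    rw [← integrable_norm_rpow_iff hNc.aestronglyMeasurable
      (ENNReal.ofReal_pos.2 hpq.pos).ne' ENNReal.ofReal_ne_top]
    refine hNpi.congr (ae_of_all _ fun z => ?_)
    simp only [Real.norm_of_nonneg (hN0 z), ENNReal.toReal_ofReal hpq.nonneg]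
  have hTc : Continuous fun z : (Fin k → ℝ) × (Fin k → ℝ) => T z.1 := hT.comp continuous_fst
  have hTL : MemLp (fun z : (Fin k → ℝ) × (Fin k → ℝ) => T z.1) (ENNReal.ofReal q) π :=
    MemLp.of_bound hTc.aestronglyMeasurable B
      (ae_of_all _ fun z => by rw [Real.norm_of_nonneg (hT0 _)]; exact hTB _)
  have hNi : Integrable N π :=
    hNL.integrable (by simpa using ENNReal.ofReal_le_ofReal hpq.lt.le)
  have hTNi : Integrable (fun z => N z * T z.1) π :=
    hNi.mul_bdd hTc.aestronglyMeasurable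
      (ae_of_all _ fun z => by rw [Real.norm_of_nonneg (hT0 _)]; exact hTB _)
  have hdiff : Integrable (fun z => l z.2 - l z.1) π :=
    (hNi.const_mul B).mono'
      ((hl.comp continuous_snd).sub (hl.comp continuous_fst)).aestronglyMeasurable
      (ae_of_all _ fun z => habs _ _)
  have hsnd : Integrable (fun z => l z.2) π := by
    refine (hdiff.add hint).congr (ae_of_all _ fun z => ?_)
    simp
  have hholder := integral_mul_le_Lp_mul_Lq_of_nonneg hpq (ae_of_all π hN0)
    (ae_of_all π fun z => hT0 z.1) hNL hTL
  have hroot : (∫ z, N z ^ p ∂π) ^ (1 / p) ≤ δ := by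
    rw [one_div, Real.rpow_inv_le_iff_of_pos
      (integral_nonneg fun z => Real.rpow_nonneg (hN0 z) p) hδ hpq.pos]
    exact hNple
  have hint0 : 0 ≤ (∫ z, T z.1 ^ q ∂π) ^ (1 / q) :=
    Real.rpow_nonneg (integral_nonneg fun z => Real.rpow_nonneg (hT0 _) _) _
  calc ∫ z, l z.2 ∂π = ∫ z, l z.1 ∂π + ∫ z, (l z.2 - l z.1) ∂π := by
        rw [integral_sub hsnd hint]; ring
    _ ≤ ∫ z, l z.1 ∂π + ∫ z, (N z * T z.1 + c * N z ^ p) ∂π := by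
        refine add_le_add le_rfl
          (integral_mono hdiff (hTNi.add (hNpi.const_mul c)) fun z => ?_)
        simpa only [mul_comm (T z.1)] using hbound z.1 z.2
    _ = ∫ z, l z.1 ∂π + (∫ z, N z * T z.1 ∂π + c * ∫ z, N z ^ p ∂π) := by
        rw [integral_add hTNi (hNpi.const_mul c), integral_const_mul]
    _ ≤ ∫ z, l z.1 ∂π + (δ * (∫ z, T z.1 ^ q ∂π) ^ (1 / q) + c * δ ^ p) := by
        gcongr
        exact hholder.trans (mul_le_mul_of_nonneg_right hroot hint0)
    _ = _ := by ring

lemma integral_le_of_Wp_le (h : IsNorm nrm) (hpq : p.HolderConjugate q)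
    (hl : Continuous l) {T : (Fin k → ℝ) → ℝ} {B c : ℝ} (hT : Continuous T)
    (hT0 : ∀ x, 0 ≤ T x) (hTB : ∀ x, T x ≤ B) (hc : 0 ≤ c)
    (hbound : ∀ x y, l y - l x ≤ T x * nrm (x - y) + c * nrm (x - y) ^ p)
    (habs : ∀ x y, |l y - l x| ≤ B * nrm (x - y)) (hlμ : Integrable l μ) (hδ : 0 ≤ δ)
    {η : Measure (Fin k → ℝ)} (hW : Wp p nrm μ η ≤ ENNReal.ofReal δ) :
    ∫ x, l x ∂η ≤ ∫ x, l x ∂μ + δ * (∫ x, T x ^ q ∂μ) ^ (1 / q) + c * δ ^ p := by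
  let F : ℝ → ℝ := fun s => ∫ x, l x ∂μ + s * (∫ x, T x ^ q ∂μ) ^ (1 / q) + c * s ^ p
  have hF : Continuous F := (continuous_const.add (continuous_id.mul continuous_const)).add
    (continuous_const.mul (Real.continuous_rpow_const hpq.nonneg))
  refine ge_of_tendsto (hF.continuousWithinAt (s := Set.Ioi δ) (x := δ)) ?_
  filter_upwards [self_mem_nhdsWithin] with s (hs : δ < s)
  have hs0 : 0 < s := hδ.trans_lt hs
  obtain ⟨π, hπ, hfst, hsnd, hcost⟩ := exists_coupling_of_Wp_lt hpq.pos
    (hW.trans_lt ((ENNReal.ofReal_lt_ofReal_iff hs0).2 hs))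
  have hTq : Continuous fun x => T x ^ q := hT.rpow_const fun _ => Or.inr hpq.symm.nonneg
  subst hfst hsnd
  simp only [F]
  rw [integral_map measurable_snd.aemeasurable hl.aestronglyMeasurable,
    integral_map measurable_fst.aemeasurable hl.aestronglyMeasurable,
    integral_map measurable_fst.aemeasurable hTq.aestronglyMeasurable]
  exact integral_snd_le_of_coupling h hpq hl hT hT0 hTB hc hbound habs π hs0.le
    ((integrable_map_measure hl.aestronglyMeasurable measurable_fst.aemeasurable).1 hlμ) hcost

/-- Moving mass along a vector field of unit `L^p` norm costs at most the step size. -/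
lemma Wp_map_add_smul_le (h : IsNorm nrm) [IsProbabilityMeasure μ] (hp : 0 < p) (hδ : 0 ≤ δ)
    {w : (Fin k → ℝ) → (Fin k → ℝ)} (hw : Measurable w)
    (hcost : ∫⁻ x, ENNReal.ofReal (nrm (w x) ^ p) ∂μ ≤ 1) :
    Wp p nrm μ (μ.map fun x => x + δ • w x) ≤ ENNReal.ofReal δ := by
  have hm : Measurable fun x => x + δ • w x := by fun_prop
  have hm2 : Measurable fun x => (x, x + δ • w x) := measurable_id.prodMk hm
  refine iInf_le_of_le (μ.map fun x => (x, x + δ • w x)) ?_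
  refine iInf_le_of_le (Measure.isProbabilityMeasure_map hm2.aemeasurable) ?_
  refine iInf_le_of_le ?_ (iInf_le_of_le ?_ ?_)
  · rw [Measure.map_map measurable_fst hm2]
    exact Measure.map_id
  · rw [Measure.map_map measurable_snd hm2]
    rfl
  rw [one_div, ENNReal.rpow_inv_le_iff hp, ENNReal.ofReal_rpow_of_nonneg hδ hp.le]
  rw [lintegral_map _ hm2]
  · calc ∫⁻ x, ENNReal.ofReal (nrm (x - (x + δ • w x)) ^ p) ∂μ
        = ∫⁻ x, ENNReal.ofReal (δ ^ p) * ENNReal.ofReal (nrm (w x) ^ p) ∂μ := by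
          refine lintegral_congr fun x => ?_
          rw [sub_add_cancel_left, h.neg, h.smul, abs_of_nonneg hδ,
            Real.mul_rpow hδ (h.nonneg _), ENNReal.ofReal_mul (Real.rpow_nonneg hδ p)]
      _ = ENNReal.ofReal (δ ^ p) * ∫⁻ x, ENNReal.ofReal (nrm (w x) ^ p) ∂μ :=
          lintegral_const_mul' _ _ ENNReal.ofReal_ne_top
      _ ≤ ENNReal.ofReal (δ ^ p) := mul_le_of_le_one_right' hcost
  · exact (((h.continuous.comp (continuous_fst.sub continuous_snd)).rpow_const
      fun _ => Or.inr hp.le).measurable).ennreal_ofReal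

/-- First-order expansion of the expectation along a bounded vector field. -/
lemma tendsto_integral_slope (h : IsNorm nrm) [IsProbabilityMeasure μ]
    (hl : Differentiable ℝ l) {B : ℝ} (hB0 : 0 ≤ B) (hB : ∀ x, dualNorm nrm (grad l x) ≤ B)
    {w : (Fin k → ℝ) → (Fin k → ℝ)} (hw : Measurable w) {M : ℝ} (hM : ∀ x, nrm (w x) ≤ M) :
    Tendsto (fun δ : ℝ => ∫ x, δ⁻¹ * (l (x + δ • w x) - l x) ∂μ) (nhdsWithin 0 (Set.Ioi 0))
      (nhds (∫ x, pairing (w x) (grad l x) ∂μ)) := by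
  refine tendsto_integral_filter_of_dominated_convergence (fun _ => B * M) ?_ ?_
    (integrable_const _) (ae_of_all _ fun x => ?_)
  · refine Eventually.of_forall fun δ => Measurable.aestronglyMeasurable ?_
    have hlm := hl.continuous.measurable
    fun_prop
  · filter_upwards [self_mem_nhdsWithin] with δ (hδ : 0 < δ)
    refine ae_of_all _ fun x => ?_
    have hle := abs_sub_le_mul_nrm h hl hB x (x + δ • w x)
    rw [sub_add_cancel_left, h.neg, h.smul, abs_of_pos hδ] at hle
    rw [Real.norm_eq_abs, abs_mul, abs_of_pos (inv_pos.2 hδ), inv_mul_le_iff₀ hδ]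
    calc _ ≤ B * (δ * nrm (w x)) := hle
      _ = δ * (B * nrm (w x)) := by ring
      _ ≤ δ * (B * M) := by gcongr; exact hM x
  · have hd := ((hl x).hasFDerivAt.hasLineDerivAt (w x)).tendsto_slope_zero_right
    rw [fderiv_eq_pairing_grad] at hd
    simpa using hd

end Transport

section Sensitivity

variable {k : ℕ} {nrm : (Fin k → ℝ) → ℝ} {l : (Fin k → ℝ) → ℝ} {μ : Measure (Fin k → ℝ)}
  {p q δ B : ℝ}

lemma Wp_self_le (h : IsNorm nrm) [IsProbabilityMeasure μ] (hp : 0 < p) (hδ : 0 ≤ δ) :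
    Wp p nrm μ μ ≤ ENNReal.ofReal δ := by
  have := Wp_map_add_smul_le (μ := μ) h hp hδ (w := fun _ => 0) measurable_const
    (by simp [h.zero, Real.zero_rpow hp.ne'])
  simpa using this

lemma integrable_of_lintegral_nrm_rpow_lt_top (h : IsNorm nrm) [IsProbabilityMeasure μ]
    (hp : 1 < p) (hl : Continuous l) (habs : ∀ x y, |l y - l x| ≤ B * nrm (x - y))
    (hmom : ∫⁻ x, ENNReal.ofReal (nrm x ^ p) ∂μ < ⊤) : Integrable l μ := by
  have hp0 : 0 < p := by linarith
  have hL : MemLp nrm (ENNReal.ofReal p) μ := by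
    rw [← integrable_norm_rpow_iff h.continuous.aestronglyMeasurable
      (ENNReal.ofReal_pos.2 hp0).ne' ENNReal.ofReal_ne_top]
    refine ⟨(h.continuous.norm.rpow_const fun _ => Or.inr (by simp)).aestronglyMeasurable, ?_⟩
    rw [hasFiniteIntegral_iff_ofReal
      (ae_of_all _ fun z => Real.rpow_nonneg (norm_nonneg _) _)]
    simpa only [Real.norm_of_nonneg (h.nonneg _), ENNReal.toReal_ofReal hp0.le] using hmom
  have hi : Integrable nrm μ := hL.integrable (by simpa using ENNReal.ofReal_le_ofReal hp.le)
  refine ((hi.const_mul B).add (integrable_const |l 0|)).mono' hl.aestronglyMeasurable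
    (ae_of_all _ fun x => ?_)
  have h1 := habs x 0
  rw [sub_zero] at h1
  have h2 := abs_sub_abs_le_abs_sub (l x) (l 0)
  rw [abs_sub_comm] at h2
  simp only [Pi.add_apply, Real.norm_eq_abs]
  linarith

lemma le_Vrob (h : IsNorm nrm) [IsProbabilityMeasure μ] (hpq : p.HolderConjugate q)
    (hl : Differentiable ℝ l) (hB0 : 0 ≤ B) (hB : ∀ x, dualNorm nrm (grad l x) ≤ B)
    (hlμ : Integrable l μ) (hδ : 0 ≤ δ) {η : Measure (Fin k → ℝ)} (hη : IsProbabilityMeasure η)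
    (hW : Wp p nrm μ η ≤ ENNReal.ofReal δ) : ∫ x, l x ∂η ≤ Vrob p nrm l μ δ := by
  refine le_csSup ⟨∫ x, l x ∂μ + δ * (∫ _, B ^ q ∂μ) ^ (1 / q) + 0 * δ ^ p, ?_⟩ ⟨η, hη, hW, rfl⟩
  rintro _ ⟨ν, hν, hWν, rfl⟩
  refine integral_le_of_Wp_le h hpq hl.continuous (T := fun _ => B) continuous_const
    (fun _ => hB0) (fun _ => le_rfl) le_rfl (fun x y => ?_)
    (abs_sub_le_mul_nrm h hl hB) hlμ hδ hWν
  simpa using (le_abs_self _).trans (abs_sub_le_mul_nrm h hl hB x y)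

lemma Vrob_le (h : IsNorm nrm) [IsProbabilityMeasure μ] (hpq : p.HolderConjugate q)
    (hl : ContDiff ℝ 1 l) (hB0 : 0 ≤ B) (hB : ∀ x, dualNorm nrm (grad l x) ≤ B)
    (hlμ : Integrable l μ) (hδ : 0 ≤ δ) {r : ℝ} (hr : 0 < r) :
    Vrob p nrm l μ δ ≤ ∫ x, l x ∂μ +
      δ * (∫ x, ballSup nrm (fun z => dualNorm nrm (grad l z)) r x ^ q ∂μ) ^ (1 / q) +
      B / r ^ (p - 1) * δ ^ p := by
  have hld := hl.differentiable one_ne_zero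
  refine csSup_le ⟨_, μ, ‹_›, Wp_self_le h hpq.pos hδ, rfl⟩ ?_
  rintro _ ⟨η, hη, hW, rfl⟩
  have hcont := continuous_ballSup h ((continuous_dualNorm h).comp (continuous_grad hl))
  exact integral_le_of_Wp_le h hpq hl.continuous
    (hcont.comp (Continuous.prodMk_right r))
    (ballSup_nonneg h hB (fun z => dualNorm_nonneg h _) r) (ballSup_le h hB r)
    (div_nonneg hB0 (Real.rpow_nonneg hr.le _))
    (sub_le_ballSup_mul_add h hld hB0 hB hpq.lt hr) (abs_sub_le_mul_nrm h hld hB) hlμ hδ hW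

lemma Vrob_zero (h : IsNorm nrm) [IsProbabilityMeasure μ] (hpq : p.HolderConjugate q)
    (hl : ContDiff ℝ 1 l) (hB0 : 0 ≤ B) (hB : ∀ x, dualNorm nrm (grad l x) ≤ B)
    (hlμ : Integrable l μ) : Vrob p nrm l μ 0 = ∫ x, l x ∂μ := by
  refine le_antisymm ?_ (le_Vrob h hpq (hl.differentiable one_ne_zero) hB0 hB hlμ le_rfl ‹_›
    (Wp_self_le h hpq.pos le_rfl))
  simpa [Real.zero_rpow hpq.ne_zero] using Vrob_le h hpq hl hB0 hB hlμ le_rfl one_pos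

lemma tendsto_integral_ballSup (h : IsNorm nrm) [IsProbabilityMeasure μ] (hq : 0 < q)
    {g : (Fin k → ℝ) → ℝ} (hg : Continuous g) (hg0 : ∀ x, 0 ≤ g x) (hB : ∀ x, g x ≤ B) :
    Tendsto (fun r => (∫ x, ballSup nrm g r x ^ q ∂μ) ^ (1 / q)) (nhds 0)
      (nhds ((∫ x, g x ^ q ∂μ) ^ (1 / q))) := by
  have hcont := (continuous_ballSup h hg).rpow_const (p := q) fun _ => Or.inr hq.le
  have hc : Continuous fun r => ∫ x, ballSup nrm g r x ^ q ∂μ := by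
    refine continuous_of_dominated (bound := fun _ => B ^ q)
      (fun r => (hcont.comp (Continuous.prodMk_right r)).aestronglyMeasurable)
      (fun r => ae_of_all _ fun x => ?_) (integrable_const _)
      (ae_of_all _ fun x => hcont.comp (Continuous.prodMk_left x))
    have h0 := ballSup_nonneg h hB hg0 r x
    rw [Real.norm_of_nonneg (Real.rpow_nonneg h0 q)]
    exact Real.rpow_le_rpow h0 (ballSup_le h hB r x) hq.le
  have := (hc.rpow_const (p := 1 / q) fun _ => Or.inr (by positivity)).tendsto 0
  simpa only [ballSup_zero h] using this

/-- A bounded Borel vector field of unit `L^p` norm that almost attains the `L^q` norm of the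
dual norm of the gradient. -/
lemma exists_measurable_almost_optimal (h : IsNorm nrm) [IsProbabilityMeasure μ]
    (hpq : p.HolderConjugate q) (hl : ContDiff ℝ 1 l) (hB0 : 0 ≤ B)
    (hB : ∀ x, dualNorm nrm (grad l x) ≤ B) {ε : ℝ} (hε : 0 < ε) :
    ∃ (w : (Fin k → ℝ) → (Fin k → ℝ)) (M : ℝ), Measurable w ∧ (∀ x, nrm (w x) ≤ M) ∧
      ∫⁻ x, ENNReal.ofReal (nrm (w x) ^ p) ∂μ ≤ 1 ∧
      (∫ x, dualNorm nrm (grad l x) ^ q ∂μ) ^ (1 / q) ≤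
        ∫ x, pairing (w x) (grad l x) ∂μ + ε := by
  let g : (Fin k → ℝ) → ℝ := fun x => dualNorm nrm (grad l x)
  have hgc : Continuous g := (continuous_dualNorm h).comp (continuous_grad hl)
  have hg0 : ∀ x, 0 ≤ g x := fun x => dualNorm_nonneg h _
  have hq0 := hpq.symm.pos
  have hq1 : 0 < q - 1 := sub_pos.2 hpq.symm.lt
  set S := ∫ x, g x ^ q ∂μ with hS
  have hS0 : 0 ≤ S := integral_nonneg fun x => Real.rpow_nonneg (hg0 x) q
  have hgq : Integrable (fun x => g x ^ q) μ :=
    Integrable.of_bound (hgc.rpow_const fun _ => Or.inr hq0.le).aestronglyMeasurable (B ^ q)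
      (ae_of_all _ fun x => by
        rw [Real.norm_of_nonneg (Real.rpow_nonneg (hg0 x) q)]
        exact Real.rpow_le_rpow (hg0 x) (hB x) hq0.le)
  rcases hS0.eq_or_lt with hS1 | hS1
  · refine ⟨fun _ => 0, 0, measurable_const, fun _ => h.zero.le, ?_, ?_⟩
    · simp [h.zero, Real.zero_rpow hpq.ne_zero]
    · rw [← hS1, Real.zero_rpow (by positivity)]
      simpa [pairing] using hε.le
  set Y := S ^ (1 / q) with hY
  have hY0 : 0 < Y := Real.rpow_pos_of_pos hS1 _
  have hYq : Y ^ q = S := by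
    rw [hY, one_div, Real.rpow_inv_rpow hS0 hq0.ne']
  let a : (Fin k → ℝ) → ℝ := fun x => (g x / Y) ^ (q - 1)
  have hac : Continuous a := (hgc.div_const Y).rpow_const fun _ => Or.inr hq1.le
  have ha0 : ∀ x, 0 ≤ a x := fun x => Real.rpow_nonneg (div_nonneg (hg0 x) hY0.le) _
  let M := (B / Y) ^ (q - 1)
  have haM : ∀ x, a x ≤ M := fun x =>
    Real.rpow_le_rpow (div_nonneg (hg0 x) hY0.le) (by gcongr; exact hB x) hq1.le
  have hM0 : 0 ≤ M := (ha0 0).trans (haM 0)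
  have hap : ∀ x, a x ^ p = g x ^ q / S := fun x => by
    rw [← Real.rpow_mul (div_nonneg (hg0 x) hY0.le), hpq.symm.sub_one_mul_conj,
      Real.div_rpow (hg0 x) hY0.le, hYq]
  have hag : ∀ x, a x * g x = g x ^ q / S * Y := fun x => by
    have : a x * (g x / Y) = g x ^ q / S := by
      rw [← hYq, ← Real.div_rpow (hg0 x) hY0.le]
      rcases (div_nonneg (hg0 x) hY0.le).eq_or_lt with h0 | h0
      · rw [← h0, Real.zero_rpow hq0.ne', mul_zero]
      · simp only [a]
        rw [Real.rpow_sub_one h0.ne', div_mul_cancel₀ _ h0.ne']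
    rw [← this]
    field_simp
  obtain ⟨J, hJm, hJ1, hJ⟩ := exists_measurable_dualNorm_le_pairing_add h
    (ε := ε / (M + 1)) (by positivity)
  have hgm := (continuous_grad hl).measurable
  have hJg : Measurable fun x => J (grad l x) := hJm.comp hgm
  have hwm : Measurable fun x => a x • J (grad l x) := hac.measurable.smul hJg
  have hwa : ∀ x, nrm (a x • J (grad l x)) ≤ a x := fun x => by
    rw [h.smul, abs_of_nonneg (ha0 x)]
    exact mul_le_of_le_one_right (ha0 x) (hJ1 _)
  refine ⟨fun x => a x • J (grad l x), M, hwm, fun x => (hwa x).trans (haM x), ?_, ?_⟩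
  · calc ∫⁻ x, ENNReal.ofReal (nrm (a x • J (grad l x)) ^ p) ∂μ
        ≤ ∫⁻ x, ENNReal.ofReal (g x ^ q / S) ∂μ := by
          refine lintegral_mono fun x => ENNReal.ofReal_le_ofReal ?_
          rw [← hap]
          exact Real.rpow_le_rpow (h.nonneg _) (hwa x) hpq.nonneg
      _ = ENNReal.ofReal (∫ x, g x ^ q / S ∂μ) :=
          (ofReal_integral_eq_lintegral_ofReal (hgq.div_const S)
            (ae_of_all _ fun x => div_nonneg (Real.rpow_nonneg (hg0 x) q) hS0)).symm
      _ = 1 := by rw [integral_div, ← hS, div_self hS1.ne', ENNReal.ofReal_one]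
      _ ≤ 1 := le_rfl
  · have hpi : Integrable (fun x => pairing (a x • J (grad l x)) (grad l x)) μ := by
      refine Integrable.of_bound
        (continuous_pairing.measurable.comp (hwm.prodMk hgm)).aestronglyMeasurable (M * B)
        (ae_of_all _ fun x => (abs_pairing_le h _ _).trans ?_)
      exact mul_le_mul ((hwa x).trans (haM x)) (hB x) (hg0 x) hM0
    calc Y = ∫ x, g x ^ q / S * Y ∂μ := by
          rw [integral_mul_const, integral_div, ← hS, div_self hS1.ne', one_mul]
      _ ≤ ∫ x, (pairing (a x • J (grad l x)) (grad l x) + ε) ∂μ := by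
          refine integral_mono ((hgq.div_const S).mul_const Y)
            (hpi.add (integrable_const ε)) fun x => ?_
          simp only [← hag, pairing_smul_left]
          have h1 := mul_le_mul_of_nonneg_left (hJ (grad l x)) (ha0 x)
          have h2 : a x * (ε / (M + 1)) ≤ ε := by
            rw [mul_div_left_comm]
            exact mul_le_of_le_one_right hε.le
              ((div_le_one (by positivity)).2 (by linarith [haM x]))
          rw [mul_add] at h1
          linarith
      _ = ∫ x, pairing (a x • J (grad l x)) (grad l x) ∂μ + ε := by
          rw [integral_add hpi (integrable_const ε)]
          simp

lemma integral_slope_le_Vrob_slope (h : IsNorm nrm) [IsProbabilityMeasure μ]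
    (hpq : p.HolderConjugate q) (hl : ContDiff ℝ 1 l) (hB0 : 0 ≤ B)
    (hB : ∀ x, dualNorm nrm (grad l x) ≤ B) (hlμ : Integrable l μ) (hδ : 0 < δ)
    {w : (Fin k → ℝ) → (Fin k → ℝ)} (hw : Measurable w) {M : ℝ} (hM : ∀ x, nrm (w x) ≤ M)
    (hcost : ∫⁻ x, ENNReal.ofReal (nrm (w x) ^ p) ∂μ ≤ 1) :
    ∫ x, δ⁻¹ * (l (x + δ • w x) - l x) ∂μ ≤ δ⁻¹ * (Vrob p nrm l μ δ - ∫ x, l x ∂μ) := by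
  have hld := hl.differentiable one_ne_zero
  have hm : Measurable fun x => x + δ • w x := by fun_prop
  have hlm := hl.continuous.measurable
  have hdiff : Integrable (fun x => l (x + δ • w x) - l x) μ := by
    refine Integrable.of_bound (by fun_prop) (B * (δ * M)) (ae_of_all _ fun x => ?_)
    refine (abs_sub_le_mul_nrm h hld hB x (x + δ • w x)).trans ?_
    rw [sub_add_cancel_left, h.neg, h.smul, abs_of_pos hδ]
    gcongr
    exact hM x
  have hint : Integrable (fun x => l (x + δ • w x)) μ := by
    refine (hdiff.add hlμ).congr (ae_of_all _ fun x => ?_)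
    simp
  have hle := le_Vrob h hpq hld hB0 hB hlμ hδ.le (Measure.isProbabilityMeasure_map hm.aemeasurable)
    (Wp_map_add_smul_le h hpq.pos hδ.le hw hcost)
  rw [integral_map hm.aemeasurable hl.continuous.aestronglyMeasurable] at hle
  rw [integral_const_mul, integral_sub hint hlμ]
  gcongr

end Sensitivity

theorem stmt1 {k : ℕ} (p q : ℝ) (hp : 1 < p) (hq : 1 < q) (hpq : 1 / p + 1 / q = 1)
    (nrm : (Fin k → ℝ) → ℝ) (hnrm : IsNorm nrm)
    (l : (Fin k → ℝ) → ℝ) (hlip : ∃ K : ℝ≥0, LipschitzWith K l)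
    (hsmooth : ContDiff ℝ 1 l)
    (μ : Measure (Fin k → ℝ)) (hμ : IsProbabilityMeasure μ)
    (hmom : ∫⁻ x, ENNReal.ofReal (nrm x ^ p) ∂μ < ⊤)
    (Υ : ℝ)
    (hΥ : Υ = (∫ x, dualNorm nrm (grad l x) ^ q ∂μ) ^ (1 / q)) :
    Tendsto (fun δ : ℝ =>
        (Vrob p nrm l μ δ - Vrob p nrm l μ 0 - δ * Υ) / δ)
      (nhdsWithin 0 (Set.Ioi 0)) (nhds 0) := by
  have hpq' : p.HolderConjugate q :=
    Real.holderConjugate_iff.2 ⟨hp, by simpa only [one_div] using hpq⟩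
  obtain ⟨B, hB0, hB⟩ := exists_dualNorm_grad_le hnrm hlip
  have hld := hsmooth.differentiable one_ne_zero
  have hlμ := integrable_of_lintegral_nrm_rpow_lt_top hnrm hp hsmooth.continuous
    (abs_sub_le_mul_nrm hnrm hld hB) hmom
  rw [Vrob_zero hnrm hpq' hsmooth hB0 hB hlμ]
  refine tendsto_order.2 ⟨fun a ha => ?_, fun a ha => ?_⟩
  · obtain ⟨w, M, hw, hM, hcost, hopt⟩ := exists_measurable_almost_optimal (μ := μ) hnrm hpq'
      hsmooth hB0 hB (ε := -a / 2) (by linarith)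
    rw [← hΥ] at hopt
    have hlim := tendsto_integral_slope (μ := μ) hnrm hld hB0 hB hw hM
    filter_upwards [self_mem_nhdsWithin, hlim.eventually_const_lt (u := Υ + a) (by linarith)]
      with δ (hδ : 0 < δ) hgt
    have hle := integral_slope_le_Vrob_slope hnrm hpq' hsmooth hB0 hB hlμ hδ hw hM hcost
    have heq : (Vrob p nrm l μ δ - ∫ x, l x ∂μ - δ * Υ) / δ =
        δ⁻¹ * (Vrob p nrm l μ δ - ∫ x, l x ∂μ) - Υ := by
      field_simp
    rw [heq]
    linarith
  · have hA := tendsto_integral_ballSup (μ := μ) (q := q) hnrm (by linarith)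
      ((continuous_dualNorm hnrm).comp (continuous_grad hsmooth))
      (fun x => dualNorm_nonneg hnrm _) hB
    simp only [Function.comp_def, ← hΥ] at hA
    obtain ⟨r, hrA, hr : 0 < r⟩ := (((hA.mono_left nhdsWithin_le_nhds).eventually_lt_const
      (u := Υ + a / 2) (by linarith)).and
        (self_mem_nhdsWithin (s := Set.Ioi (0 : ℝ)))).exists
    have hpow : Tendsto (fun δ : ℝ => B / r ^ (p - 1) * δ ^ (p - 1)) (nhds 0) (nhds 0) := by
      have := ((Real.continuous_rpow_const (q := p - 1) (by linarith)).tendsto 0).const_mul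
        (B / r ^ (p - 1))
      simpa [Real.zero_rpow (sub_pos.2 hp).ne'] using this
    filter_upwards [self_mem_nhdsWithin, (hpow.mono_left nhdsWithin_le_nhds).eventually_lt_const
      (u := a / 2) (by linarith)] with δ (hδ : 0 < δ) hlt
    have hle := Vrob_le hnrm hpq' hsmooth hB0 hB hlμ hδ.le hr
    rw [div_lt_iff₀ hδ]
    have hsplit : B / r ^ (p - 1) * δ ^ p = δ * (B / r ^ (p - 1) * δ ^ (p - 1)) := by
      rw [Real.rpow_sub_one hδ.ne' p]
      field_simp
    rw [hsplit] at hle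
    have h1 := mul_lt_mul_of_pos_left hrA hδ
    have h2 := mul_lt_mul_of_pos_left hlt hδ
    linarith
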